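/- arXiv:1011.5883 — 2 statements merged into one kernel-verified Lean document; each statement's English description precedes it below -/
import Mathlib

section
/- For every m ≥ 1, the number of perfect matchings of CGG(2m) all of whose edges have odd order is exactly m!. -/
/-- The vertex set of the complete convex geometric graph `CGG(2m)`:
the vertices are labelled cyclically by `0, 1, …, 2m-1`. -/
abbrev Vtx (m : ℕ) := ZMod (2 * m)

/-- The order of an edge `{i,j}` of `CGG(2m)`: `min (|i-j|, 2m - |i-j|)`. -/
def edgeOrder (m : ℕ) : Sym2 (Vtx m) → ℕ :=
  Sym2.lift ⟨fun i j => min (i - j).val (j - i).val, fun i j => min_comm _ _⟩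

/-- The direction of an edge `{i,j}` of `CGG(2m)`: `i + j (mod 2m)`. -/
def edgeDir (m : ℕ) : Sym2 (Vtx m) → Vtx m :=
  Sym2.lift ⟨fun i j => i + j, fun i j => add_comm i j⟩

/-- `x` lies on the open cyclic arc from `a` to `b`, taken counterclockwise. -/
def InArc (m : ℕ) (a b x : Vtx m) : Prop :=
  0 < (x - a).val ∧ (x - a).val < (b - a).val

/-- Two edges of `CGG(2m)` cross: their endpoints interleave in the cyclic order,
i.e. writing them as `{a,b}` and `{c,d}`, exactly one of `c, d` lies on the open
cyclic arc from `a` to `b` taken counterclockwise. -/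
def Crosses (m : ℕ) (e f : Sym2 (Vtx m)) : Prop :=
  ∃ a b c d : Vtx m, e = s(a, b) ∧ f = s(c, d) ∧
    Xor' (InArc m a b c) (InArc m a b d)

/-- Two edges of `CGG(2m)` are neighbors: some endpoint of one differs by `±1`
(mod `2m`) from some endpoint of the other. -/
def Neighbors (m : ℕ) (e f : Sym2 (Vtx m)) : Prop :=
  ∃ x ∈ e, ∃ y ∈ f, x = y + 1 ∨ y = x + 1

/-- `M` is a perfect matching of `CGG(2m)`: a set of pairwise vertex-disjoint
edges covering all `2m` vertices. -/
def IsPM (m : ℕ) (M : Finset (Sym2 (Vtx m))) : Prop :=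
  (∀ e ∈ M, ¬ e.IsDiag) ∧
  (∀ e ∈ M, ∀ f ∈ M, e ≠ f → ∀ x : Vtx m, x ∈ e → x ∉ f) ∧
  (∀ x : Vtx m, ∃ e ∈ M, x ∈ e)

/-- `M` is a simple perfect matching (SPM) of `CGG(2m)`: a perfect matching
no two of whose edges cross. -/
def IsSPM (m : ℕ) (M : Finset (Sym2 (Vtx m))) : Prop :=
  IsPM m M ∧ ∀ e ∈ M, ∀ f ∈ M, e ≠ f → ¬ Crosses m e f

/-- `M` is a semi-simple perfect matching of `CGG(2m)`: a perfect matching all of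
whose edges have odd order, and no two neighboring edges of which cross. -/
def IsSemiSimple (m : ℕ) (M : Finset (Sym2 (Vtx m))) : Prop :=
  IsPM m M ∧ (∀ e ∈ M, Odd (edgeOrder m e)) ∧
  ∀ e ∈ M, ∀ f ∈ M, e ≠ f → Neighbors m e f → ¬ Crosses m e f

/-- `B` is a set of edges of `CGG(2m)` that meets every member of the family `F`,
of minimum cardinality among all sets of edges meeting every member of `F`. -/
def MinTransversal (m : ℕ) (F : Set (Finset (Sym2 (Vtx m))))
    (B : Finset (Sym2 (Vtx m))) : Prop :=
  (∀ e ∈ B, ¬ e.IsDiag) ∧ (∀ M ∈ F, (B ∩ M).Nonempty) ∧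
  ∀ B' : Finset (Sym2 (Vtx m)), (∀ e ∈ B', ¬ e.IsDiag) →
    (∀ M ∈ F, (B' ∩ M).Nonempty) → B.card ≤ B'.card

/-- `B` is a blocker of `CGG(2m)`: a set of edges meeting every SPM, of minimum
cardinality among all sets of edges meeting every SPM. -/
def IsBlocker (m : ℕ) (B : Finset (Sym2 (Vtx m))) : Prop :=
  MinTransversal m {M | IsSPM m M} B

/-- `C` is a co-blocker of `CGG(2m)`: a set of edges meeting every blocker, of
minimum cardinality among all sets of edges meeting every blocker. -/
def IsCoBlocker (m : ℕ) (C : Finset (Sym2 (Vtx m))) : Prop :=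
  MinTransversal m {B | IsBlocker m B} C

/-- The reduction modulo `2` of a vertex of `CGG(2m)`. -/
def vtxParity (m : ℕ) : Vtx m →+* ZMod 2 :=
  ZMod.castHom (Dvd.intro m rfl) (ZMod 2)

theorem odd_val_iff_vtxParity_eq_one (m : ℕ) [NeZero m] (x : Vtx m) :
    Odd x.val ↔ vtxParity m x = 1 := by
  rw [← ZMod.natCast_eq_one_iff_odd, ZMod.natCast_val]
  rfl

theorem odd_edgeOrder_iff (m : ℕ) [NeZero m] (x y : Vtx m) :
    Odd (edgeOrder m s(x, y)) ↔ vtxParity m x ≠ vtxParity m y := by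
  have key : ∀ a b : ZMod 2, (a - b = 1 ↔ a ≠ b) := by decide
  have h₁ := odd_val_iff_vtxParity_eq_one m (x - y)
  have h₂ := odd_val_iff_vtxParity_eq_one m (y - x)
  rw [map_sub, key] at h₁ h₂
  rw [ne_comm] at h₂
  change Odd (min (x - y).val (y - x).val) ↔ _
  rcases min_choice (x - y).val (y - x).val with h | h <;> rw [h] <;> assumption

/-- The `i`-th even vertex of `CGG(2m)`. -/
def evenVtx (m : ℕ) (i : Fin m) : Vtx m := ((2 * i.val : ℕ) : Vtx m)

/-- The `i`-th odd vertex of `CGG(2m)`. -/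
def oddVtx (m : ℕ) (i : Fin m) : Vtx m := ((2 * i.val + 1 : ℕ) : Vtx m)

theorem vtxParity_evenVtx (m : ℕ) (i : Fin m) : vtxParity m (evenVtx m i) = 0 := by
  rw [evenVtx, map_natCast, ZMod.natCast_eq_zero_iff_even]
  exact even_two_mul _

theorem vtxParity_oddVtx (m : ℕ) (i : Fin m) : vtxParity m (oddVtx m i) = 1 := by
  rw [oddVtx, map_natCast, ZMod.natCast_eq_one_iff_odd]
  exact odd_two_mul_add_one _

theorem evenVtx_injective (m : ℕ) : Function.Injective (evenVtx m) := by
  intro i j h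
  have h' := congrArg ZMod.val h
  rw [evenVtx, evenVtx, ZMod.val_cast_of_lt (by omega), ZMod.val_cast_of_lt (by omega)] at h'
  exact Fin.ext (by omega)

theorem oddVtx_injective (m : ℕ) : Function.Injective (oddVtx m) := by
  intro i j h
  have h' := congrArg ZMod.val h
  rw [oddVtx, oddVtx, ZMod.val_cast_of_lt (by omega), ZMod.val_cast_of_lt (by omega)] at h'
  exact Fin.ext (by omega)

theorem evenVtx_ne_oddVtx (m : ℕ) (i j : Fin m) : evenVtx m i ≠ oddVtx m j := by
  intro h
  have h' := congrArg (vtxParity m) h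
  rw [vtxParity_evenVtx, vtxParity_oddVtx] at h'
  exact zero_ne_one h'

theorem exists_eq_evenVtx_or_oddVtx (m : ℕ) [NeZero m] (x : Vtx m) :
    ∃ i, x = evenVtx m i ∨ x = oddVtx m i := by
  have hx := ZMod.val_lt x
  refine ⟨⟨x.val / 2, by omega⟩, ?_⟩
  rcases Nat.even_or_odd' x.val with ⟨k, hk | hk⟩
  · left
    rw [evenVtx, show 2 * (x.val / 2) = x.val by omega, ZMod.natCast_zmod_val]
  · right
    rw [oddVtx, show 2 * (x.val / 2) + 1 = x.val by omega, ZMod.natCast_zmod_val]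

theorem odd_edgeOrder_evenVtx_oddVtx (m : ℕ) [NeZero m] (i j : Fin m) :
    Odd (edgeOrder m s(evenVtx m i, oddVtx m j)) := by
  rw [odd_edgeOrder_iff, vtxParity_evenVtx, vtxParity_oddVtx]
  exact zero_ne_one

theorem exists_eq_oddVtx_of_odd_edgeOrder {m : ℕ} [NeZero m] {i : Fin m} {y : Vtx m}
    (h : Odd (edgeOrder m s(evenVtx m i, y))) : ∃ j, y = oddVtx m j := by
  obtain ⟨j, rfl | rfl⟩ := exists_eq_evenVtx_or_oddVtx m y
  · rw [odd_edgeOrder_iff, vtxParity_evenVtx, vtxParity_evenVtx] at h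
    exact absurd rfl h
  · exact ⟨j, rfl⟩

theorem exists_evenVtx_mem_of_odd_edgeOrder {m : ℕ} [NeZero m] {e : Sym2 (Vtx m)}
    (h : Odd (edgeOrder m e)) : ∃ i, evenVtx m i ∈ e := by
  induction e with | _ x y
  obtain ⟨i, rfl | rfl⟩ := exists_eq_evenVtx_or_oddVtx m x
  · exact ⟨i, Sym2.mem_mk_left _ _⟩
  obtain ⟨j, rfl | rfl⟩ := exists_eq_evenVtx_or_oddVtx m y
  · exact ⟨j, Sym2.mem_mk_right _ _⟩
  · rw [odd_edgeOrder_iff, vtxParity_oddVtx, vtxParity_oddVtx] at h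
    exact absurd rfl h

theorem mk_evenVtx_oddVtx_inj {m : ℕ} {i j k l : Fin m} :
    s(evenVtx m i, oddVtx m j) = s(evenVtx m k, oddVtx m l) ↔ i = k ∧ j = l := by
  simp [(evenVtx_injective m).eq_iff, (oddVtx_injective m).eq_iff, evenVtx_ne_oddVtx]

/-- The edges joining the `i`-th even vertex to the `σ i`-th odd vertex. -/
def permMatching (m : ℕ) (σ : Equiv.Perm (Fin m)) : Finset (Sym2 (Vtx m)) :=
  Finset.univ.image fun i => s(evenVtx m i, oddVtx m (σ i))

theorem mem_permMatching {m : ℕ} {σ : Equiv.Perm (Fin m)} {e : Sym2 (Vtx m)} :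
    e ∈ permMatching m σ ↔ ∃ i, s(evenVtx m i, oddVtx m (σ i)) = e := by
  simp [permMatching]

theorem isPM_permMatching (m : ℕ) [NeZero m] (σ : Equiv.Perm (Fin m)) :
    IsPM m (permMatching m σ) := by
  simp only [IsPM, mem_permMatching]
  refine ⟨?_, ?_, fun x => ?_⟩
  · rintro _ ⟨i, rfl⟩
    simpa using evenVtx_ne_oddVtx m i (σ i)
  · rintro _ ⟨i, rfl⟩ _ ⟨j, rfl⟩ hne x hx hy
    have hij : i ≠ j := by rintro rfl; exact hne rfl
    rw [Sym2.mem_iff] at hx hy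
    rcases hx with rfl | rfl <;> rcases hy with h | h
    · exact hij (evenVtx_injective m h)
    · exact evenVtx_ne_oddVtx m _ _ h
    · exact evenVtx_ne_oddVtx m _ _ h.symm
    · exact hij (σ.injective (oddVtx_injective m h))
  · obtain ⟨i, rfl | rfl⟩ := exists_eq_evenVtx_or_oddVtx m x
    · exact ⟨_, ⟨i, rfl⟩, Sym2.mem_mk_left _ _⟩
    · refine ⟨_, ⟨σ.symm i, rfl⟩, ?_⟩
      rw [σ.apply_symm_apply]
      exact Sym2.mem_mk_right _ _

theorem odd_edgeOrder_of_mem_permMatching {m : ℕ} [NeZero m] {σ : Equiv.Perm (Fin m)}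
    {e : Sym2 (Vtx m)} (he : e ∈ permMatching m σ) : Odd (edgeOrder m e) := by
  obtain ⟨i, rfl⟩ := mem_permMatching.1 he
  exact odd_edgeOrder_evenVtx_oddVtx m i (σ i)

theorem permMatching_injective (m : ℕ) : Function.Injective (permMatching m) := by
  intro σ τ h
  ext i : 1
  have hi : s(evenVtx m i, oddVtx m (σ i)) ∈ permMatching m τ :=
    h ▸ mem_permMatching.2 ⟨i, rfl⟩
  obtain ⟨k, hk⟩ := mem_permMatching.1 hi
  obtain ⟨rfl, hk⟩ := mk_evenVtx_oddVtx_inj.1 hk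
  exact hk.symm

theorem IsPM.eq_of_mem {m : ℕ} {M : Finset (Sym2 (Vtx m))} (hM : IsPM m M)
    {e f : Sym2 (Vtx m)} (he : e ∈ M) (hf : f ∈ M) {x : Vtx m} (hxe : x ∈ e) (hxf : x ∈ f) :
    e = f := by
  by_contra hne
  exact hM.2.1 e he f hf hne x hxe hxf

theorem IsPM.exists_permMatching_eq {m : ℕ} [NeZero m] {M : Finset (Sym2 (Vtx m))}
    (hM : IsPM m M) (hodd : ∀ e ∈ M, Odd (edgeOrder m e)) : ∃ σ, permMatching m σ = M := by
  have hex : ∀ i, ∃ j, s(evenVtx m i, oddVtx m j) ∈ M := by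
    intro i
    obtain ⟨e, he, y, rfl⟩ := hM.2.2 (evenVtx m i)
    obtain ⟨j, rfl⟩ := exists_eq_oddVtx_of_odd_edgeOrder (hodd _ he)
    exact ⟨j, he⟩
  choose f hf using hex
  have hinj : Function.Injective f := by
    intro i k hik
    refine (mk_evenVtx_oddVtx_inj.1 (hM.eq_of_mem (hf i) (hf k)
      (Sym2.mem_mk_right _ _) ?_)).1
    rw [hik]
    exact Sym2.mem_mk_right _ _
  refine ⟨Equiv.ofBijective f (Finite.injective_iff_bijective.1 hinj), ?_⟩
  ext e
  rw [mem_permMatching]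
  constructor
  · rintro ⟨i, rfl⟩
    exact hf i
  · intro he
    obtain ⟨i, hi⟩ := exists_evenVtx_mem_of_odd_edgeOrder (hodd e he)
    exact ⟨i, hM.eq_of_mem (hf i) he (Sym2.mem_mk_left _ _) hi⟩

/-- For every `m ≥ 1`, the number of perfect matchings of `CGG(2m)` all of whose
edges have odd order is exactly `m!`. -/
theorem card_odd_matchings (m : ℕ) (hm : 1 ≤ m) :
    Nat.card {M : Finset (Sym2 (Vtx m)) //
        IsPM m M ∧ ∀ e ∈ M, Odd (edgeOrder m e)} = Nat.factorial m := by
  have : NeZero m := ⟨by omega⟩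
  let F (σ : Equiv.Perm (Fin m)) : {M : Finset (Sym2 (Vtx m)) //
      IsPM m M ∧ ∀ e ∈ M, Odd (edgeOrder m e)} :=
    ⟨permMatching m σ, isPM_permMatching m σ, fun _ => odd_edgeOrder_of_mem_permMatching⟩
  have hF : Function.Bijective F := by
    refine ⟨fun σ τ h => permMatching_injective m (congrArg Subtype.val h), ?_⟩
    rintro ⟨M, hM, hodd⟩
    obtain ⟨σ, hσ⟩ := hM.exists_permMatching_eq hodd
    exact ⟨σ, Subtype.ext hσ⟩
  rw [← Nat.card_eq_of_bijective F hF, Nat.card_perm, Nat.card_fin]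
end

section
/- Let m ≥ 2 and let B be a blocker of CGG(2m). Then for every odd residue d ∈ {1, 3, …, 2m−1}, B contains exactly one edge of direction d; in particular, all edges of B have odd order. -/
/-- Reduction of the vertex labels modulo `2`. -/
def parityHom (m : ℕ) : Vtx m →+* ZMod 2 :=
  ZMod.castHom (Dvd.intro m rfl) (ZMod 2)

theorem odd_val_iff_parityHom {m : ℕ} [NeZero (2 * m)] (x : Vtx m) :
    Odd x.val ↔ parityHom m x = 1 := by
  rw [← ZMod.natCast_eq_one_iff_odd, ← map_natCast (parityHom m), ZMod.natCast_zmod_val]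

/-- The edges of direction `d`, together with the loops of that direction. -/
def parallelClass (m : ℕ) [NeZero (2 * m)] (d : Vtx m) : Finset (Sym2 (Vtx m)) :=
  Finset.univ.filter fun e => edgeDir m e = d

theorem mk_mem_parallelClass {m : ℕ} [NeZero (2 * m)] {d a b : Vtx m} :
    s(a, b) ∈ parallelClass m d ↔ a + b = d :=
  Finset.mem_filter_univ (p := fun e => edgeDir m e = d) s(a, b)

theorem InArc.reflect {m : ℕ} [NeZero (2 * m)] {a b c d : Vtx m} (h : InArc m a b c)
    (hsum : a + b = c + d) : InArc m a b d := by
  obtain ⟨h₀, h₁⟩ := h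
  have hd : d - a = (b - a) - (c - a) := by linear_combination -hsum
  unfold InArc
  rw [hd, ZMod.val_sub h₁.le]
  omega

theorem isSPM_parallelClass {m : ℕ} [NeZero (2 * m)] {d : Vtx m} (hd : Odd d.val) :
    IsSPM m (parallelClass m d) := by
  refine ⟨⟨?_, ?_, fun x => ⟨s(x, d - x), by simp [mk_mem_parallelClass], by simp⟩⟩, ?_⟩
  · intro e he hdiag
    induction e using Sym2.ind with
    | _ a b =>
      rw [mk_mem_parallelClass] at he
      rw [Sym2.mk_isDiag_iff] at hdiag
      rw [odd_val_iff_parityHom, ← he, hdiag, map_add, CharTwo.add_self_eq_zero] at hd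
      exact zero_ne_one hd
  · intro e he f hf hne x hxe hxf
    obtain ⟨y, rfl⟩ := hxe
    obtain ⟨z, rfl⟩ := hxf
    rw [mk_mem_parallelClass] at he hf
    exact hne (by rw [add_left_cancel (he.trans hf.symm)])
  · rintro e he f hf - ⟨a, b, x, y, rfl, rfl, hx⟩
    rw [mk_mem_parallelClass] at he hf
    have h := he.trans hf.symm
    rcases hx with ⟨h₁, h₂⟩ | ⟨h₁, h₂⟩
    · exact h₂ (h₁.reflect h)
    · exact h₂ (h₁.reflect (h.trans (add_comm x y)))

theorem card_inArc_zero {m : ℕ} [NeZero (2 * m)] (j : Vtx m) [DecidablePred (InArc m 0 j)] :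
    (Finset.univ.filter (InArc m 0 j)).card = j.val - 1 := by
  rw [← Finset.card_image_of_injective _ (ZMod.val_injective (2 * m))]
  have h : (Finset.univ.filter (InArc m 0 j)).image ZMod.val = Finset.Ioo 0 j.val := by
    ext k
    simp only [Finset.mem_image, Finset.mem_filter, Finset.mem_univ, true_and, InArc, sub_zero,
      Finset.mem_Ioo]
    constructor
    · rintro ⟨x, hx, rfl⟩
      exact hx
    · intro hk
      have hval : ((k : Vtx m)).val = k := ZMod.val_natCast_of_lt (hk.2.trans j.val_lt)
      exact ⟨k, by rwa [hval], hval⟩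
  rw [h, Nat.card_Ioo, Nat.sub_zero]

theorem IsPM.eq_of_mem_s18 {m : ℕ} {M : Finset (Sym2 (Vtx m))} (hM : IsPM m M) {x y z : Vtx m}
    (hy : s(x, y) ∈ M) (hz : s(x, z) ∈ M) : y = z := by
  by_contra hne
  exact hM.2.1 _ hy _ hz (fun h => hne (Sym2.congr_right.1 h)) x (by simp) (by simp)

theorem IsSPM.odd_val_of_mem {m : ℕ} [NeZero (2 * m)] {M : Finset (Sym2 (Vtx m))}
    (hM : IsSPM m M) {j : Vtx m} (hj : s(0, j) ∈ M) : Odd j.val := by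
  classical
  have hpartner : ∀ x : Vtx m, ∃ y, s(x, y) ∈ M := fun x => by
    obtain ⟨e, he, y, rfl⟩ := hM.1.2.2 x
    exact ⟨y, he⟩
  choose p hp using hpartner
  have hpp : ∀ x, p (p x) = x := fun x =>
    hM.1.eq_of_mem_s18 (hp (p x)) (by rw [Sym2.eq_swap]; exact hp x)
  have hpne : ∀ x, p x ≠ x := fun x h => hM.1.1 _ (hp x) (by simp [h])
  have harc : ∀ x, InArc m 0 j x → InArc m 0 j (p x) := by
    intro x hx
    by_contra hnot
    refine hM.2 _ hj _ (hp x) ?_ ⟨0, j, x, p x, rfl, rfl, Or.inl ⟨hx, hnot⟩⟩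
    intro heq
    have hmem : x ∈ s(0, j) := by rw [heq]; simp
    rcases Sym2.mem_iff.1 hmem with rfl | rfl <;> simp [InArc] at hx
  have hsum : ∑ x ∈ Finset.univ.filter (InArc m 0 j), (1 : ZMod 2) = 0 :=
    Finset.sum_involution (fun x _ => p x) (fun _ _ => by decide) (fun x _ _ => hpne x)
      (fun x hx => by simpa using harc x (by simpa using hx)) (fun x _ => hpp x)
  rw [Finset.sum_const, nsmul_one, card_inArc_zero, ZMod.natCast_eq_zero_iff_even] at hsum
  have hj₀ : j.val ≠ 0 := by
    rw [ZMod.val_ne_zero]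
    rintro rfl
    exact hM.1.1 _ hj (by simp)
  obtain ⟨k, hk⟩ := hsum
  exact ⟨k, by omega⟩

theorem IsBlocker.card_le_card_odd {m : ℕ} [NeZero (2 * m)] {B : Finset (Sym2 (Vtx m))}
    (hB : IsBlocker m B) :
    B.card ≤ (Finset.univ.filter fun d : Vtx m => Odd d.val).card := by
  refine (hB.2.2 ((Finset.univ.filter fun d : Vtx m => Odd d.val).image fun j => s(0, j))
    ?_ ?_).trans Finset.card_image_le
  · intro e he
    obtain ⟨j, hj, rfl⟩ := Finset.mem_image.1 he
    rw [Sym2.mk_isDiag_iff]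
    rintro rfl
    simp at hj
  · intro M hM
    obtain ⟨e, he, j, rfl⟩ := hM.1.2.2 0
    exact ⟨s(0, j), Finset.mem_inter.2 ⟨Finset.mem_image.2 ⟨j,
      by simpa using IsSPM.odd_val_of_mem hM he, rfl⟩, he⟩⟩

theorem odd_edgeOrder_of_odd_edgeDir {m : ℕ} [NeZero (2 * m)] {e : Sym2 (Vtx m)}
    (he : Odd (edgeDir m e).val) : Odd (edgeOrder m e) := by
  induction e using Sym2.ind with
  | _ a b =>
    change Odd (a + b).val at he
    change Odd (min (a - b).val (b - a).val)
    rw [odd_val_iff_parityHom, map_add] at he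
    have hab : Odd (a - b).val := by
      rw [odd_val_iff_parityHom, map_sub, CharTwo.sub_eq_add, he]
    have hba : Odd (b - a).val := by
      rw [odd_val_iff_parityHom, map_sub, CharTwo.sub_eq_add, add_comm, he]
    rcases min_choice (a - b).val (b - a).val with h | h <;> rwa [h]

/-- Let `m ≥ 2` and let `B` be a blocker of `CGG(2m)`. Then for every odd
residue `d` modulo `2m`, `B` contains exactly one edge of direction `d`; in
particular, all edges of `B` have odd order. -/
theorem blocker_unique_direction (m : ℕ) (hm : 2 ≤ m)
    (B : Finset (Sym2 (Vtx m))) (hB : IsBlocker m B) :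
    (∀ d : Vtx m, Odd d.val → ∃! e : Sym2 (Vtx m), e ∈ B ∧ edgeDir m e = d) ∧
    ∀ e ∈ B, Odd (edgeOrder m e) := by
  classical
  have : NeZero (2 * m) := ⟨by omega⟩
  have hex : ∀ d : Vtx m, Odd d.val → ∃ e ∈ B, edgeDir m e = d := fun d hd => by
    obtain ⟨e, he⟩ := hB.2.1 _ (isSPM_parallelClass hd)
    rw [Finset.mem_inter] at he
    exact ⟨e, he.1, (Finset.mem_filter.1 he.2).2⟩
  have hsub : (Finset.univ.filter fun d : Vtx m => Odd d.val) ⊆ B.image (edgeDir m) :=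
    fun d hd => Finset.mem_image.2 (hex d (by simpa using hd))
  have hcard : (B.image (edgeDir m)).card = B.card :=
    le_antisymm Finset.card_image_le (hB.card_le_card_odd.trans (Finset.card_le_card hsub))
  have heq := Finset.eq_of_subset_of_card_le hsub (hcard.trans_le hB.card_le_card_odd)
  have hinj := Finset.card_image_iff.1 hcard
  refine ⟨fun d hd => ?_, fun e he => odd_edgeOrder_of_odd_edgeDir ?_⟩
  · obtain ⟨e, he, hed⟩ := hex d hd
    exact ⟨e, ⟨he, hed⟩, fun f hf => hinj hf.1 he (hf.2.trans hed.symm)⟩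
  · have hmem := Finset.mem_image_of_mem (edgeDir m) he
    rw [← heq] at hmem
    exact (Finset.mem_filter.1 hmem).2
end
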